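/- Let χ be the corrector on C_∞ and set φ_ω(x) := x + χ(ω,x). Then φ_ω is harmonic for the random walk observed only on C_{∞,α}: for all x ∈ C_{∞,α}, (L_ω^{(α)} φ_ω)(x) = 0. -/

import Mathlib

open MeasureTheory ProbabilityTheory Filter Topology
open scoped ENNReal NNReal BigOperators
open scoped Classical

noncomputable section
namespace RCRW

/-- Sites of the lattice `ℤ^d`. -/
abbrev Site (d : ℕ) := Fin d → ℤ

/-- Nearest-neighbour edges of `ℤ^d`, encoded by their base point and direction. -/
abbrev Edge (d : ℕ) := (Fin d → ℤ) × Fin d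

/-- Environments: an assignment of a conductance to every edge. -/
abbrev Env (d : ℕ) := Edge d → ℝ

/-- Euclidean space `ℝ^d`. -/
abbrev Euc (d : ℕ) := EuclideanSpace ℝ (Fin d)

/-- The `i`-th coordinate unit vector of `ℤ^d`. -/
def unitE (d : ℕ) (i : Fin d) : Site d := fun j => if j = i then 1 else 0

/-- Canonical embedding `ℤ^d → ℝ^d`. -/
def emb (d : ℕ) (x : Site d) : Euc d := (EuclideanSpace.equiv (Fin d) ℝ).symm fun i => (x i : ℝ)

/-- `x` and `y` are nearest neighbours in `ℤ^d`. -/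
def adjacent (d : ℕ) (x y : Site d) : Prop :=
  (∃ i, y = x + unitE d i) ∨ (∃ i, x = y + unitE d i)

/-- The conductance of the (unordered) edge between `x` and `y` (zero if not an edge). -/
def condOf (d : ℕ) (ω : Env d) (x y : Site d) : ℝ :=
  if h : ∃ i, y = x + unitE d i then ω (x, h.choose)
  else if h2 : ∃ i, x = y + unitE d i then ω (y, h2.choose)
  else 0

/-- The shift of the environment by a lattice vector `z`. -/
def shiftBy (d : ℕ) (z : Site d) (ω : Env d) : Env d := fun e => ω (e.1 + z, e.2)

/-- Two sites are linked by an edge of positive conductance. -/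
def openRel (d : ℕ) (ω : Env d) (a b : Site d) : Prop :=
  adjacent d a b ∧ 0 < condOf d ω a b

/-- Two sites are linked by an edge of conductance at least `α`. -/
def geRel (d : ℕ) (ω : Env d) (α : ℝ) (a b : Site d) : Prop :=
  adjacent d a b ∧ α ≤ condOf d ω a b

/-- The infinite cluster `C∞` of edges with positive conductance: the set of sites whose
open-cluster is infinite. -/
def Cinf (d : ℕ) (ω : Env d) : Set (Site d) :=
  {x | {y | Relation.ReflTransGen (openRel d ω) x y}.Infinite}

/-- `C∞,α`: the set of sites connected to infinity by edges of conductance `≥ α`. -/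
def Cinfa (d : ℕ) (ω : Env d) (α : ℝ) : Set (Site d) :=
  {x | {y | Relation.ReflTransGen (geRel d ω α) x y}.Infinite}

/-- `P` is the law of i.i.d. random variables indexed by `ι` with one-coordinate marginal `μ`. -/
def IsIIDLaw {ι : Type*} (P : Measure (ι → ℝ)) (μ : Measure ℝ) : Prop :=
  IsProbabilityMeasure P ∧
    ∀ (s : Finset ι) (f : ι → Set ℝ), (∀ i, MeasurableSet (f i)) →
      P {ω | ∀ i ∈ s, ω i ∈ f i} = ∏ i ∈ s, μ (f i)

/-- The Bernoulli measure on `ℝ` with mass `p` at `1` and `1 - p` at `0`. -/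
def bern (p : ℝ) : Measure ℝ :=
  ENNReal.ofReal p • Measure.dirac 1 + ENNReal.ofReal (1 - p) • Measure.dirac 0

/-- The bond-percolation threshold `p_c(d)` of `ℤ^d`. -/
def pc (d : ℕ) : ℝ :=
  sInf {p : ℝ | 0 ≤ p ∧ p ≤ 1 ∧
    ∀ P : Measure (Env d), IsIIDLaw P (bern p) → 0 < P {ω | (0 : Site d) ∈ Cinf d ω}}

/-- Total conductance emanating from `x`. -/
def degSum (d : ℕ) (ω : Env d) (x : Site d) : ℝ :=
  ∑ i : Fin d, (condOf d ω x (x + unitE d i) + condOf d ω x (x - unitE d i))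

/-- One-step transition probabilities of the (lazy) random walk among conductances. -/
def stepProb (d : ℕ) (ω : Env d) (x y : Site d) : ℝ :=
  if adjacent d x y then condOf d ω x y / (2 * d)
  else if y = x then 1 - degSum d ω x / (2 * d)
  else 0

/-- `Pz` is the quenched path law `P_{ω,z}` of the walk among the conductances `ω`
started at `z`, characterized through its cylinder probabilities. -/
def IsQuenchedLaw (d : ℕ) (ω : Env d) (z : Site d) (Pz : Measure (ℕ → Site d)) : Prop :=
  IsProbabilityMeasure Pz ∧
    ∀ (n : ℕ) (γ : ℕ → Site d),
      Pz {X | ∀ k ≤ n, X k = γ k} =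
        ENNReal.ofReal ((if γ 0 = z then (1 : ℝ) else 0) *
          ∏ k ∈ Finset.range n, stepProb d ω (γ k) (γ (k + 1)))

/-- `ω̂_{xy} = P_{ω,x}(X_{T₁} = y)`: the probability that the walk started at `x` enters
`C∞,α` for the first time (after time `0`) at the site `y`; written as a sum over paths. -/
def hatStep (d : ℕ) (ω : Env d) (α : ℝ) (x y : Site d) : ℝ :=
  ∑' n : ℕ, ∑' γ : Fin (n + 2) → Site d,
    if γ 0 = x ∧ γ (Fin.last (n + 1)) = y ∧ y ∈ Cinfa d ω α ∧
        (∀ k : Fin (n + 2), k ≠ 0 → k ≠ Fin.last (n + 1) → γ k ∉ Cinfa d ω α)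
    then ∏ k : Fin (n + 1), stepProb d ω (γ k.castSucc) (γ k.succ)
    else 0

/-- `n`-step kernel of the induced walk on `C∞,α`. -/
def hatPow (d : ℕ) (ω : Env d) (α : ℝ) : ℕ → Site d → Site d → ℝ
  | 0 => fun x y => if x = y then 1 else 0
  | n + 1 => fun x y => ∑' z : Site d, hatPow d ω α n x z * hatStep d ω α z y

/-- `P_{ω,x}(Y_t = y)` for the continuous-time random walk `Y` on `C∞,α` with
generator `L_ω^{(α)}` (rate-one jumps with kernel `ω̂`). -/
def ctKernel (d : ℕ) (ω : Env d) (α : ℝ) (t : ℝ) (x y : Site d) : ℝ :=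
  ∑' n : ℕ, (Real.exp (-t) * t ^ n / n.factorial) * hatPow d ω α n x y

/-- `E_{ω,x}|Y_t - x|`: expected (Euclidean) displacement of the continuous-time walk. -/
def expDist (d : ℕ) (ω : Env d) (α : ℝ) (t : ℝ) (x : Site d) : ℝ :=
  ∑' y : Site d, ctKernel d ω α t x y * ‖emb d y - emb d x‖

/-- The generator `L_ω^{(α)}` acting on vector-valued functions. -/
def genLa (d : ℕ) (ω : Env d) (α : ℝ) (f : Site d → Euc d) (x : Site d) : Euc d :=
  ∑' y : Site d, hatStep d ω α x y • (f y - f x)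

/-- The generator `L_ω` of the walk among conductances on `ℤ^d`, acting on
vector-valued functions. -/
def latOp (d : ℕ) (ω : Env d) (f : Site d → Euc d) (x : Site d) : Euc d :=
  (2 * (d : ℝ))⁻¹ • ∑ i : Fin d,
    (condOf d ω x (x + unitE d i) • (f (x + unitE d i) - f x) +
      condOf d ω x (x - unitE d i) • (f (x - unitE d i) - f x))

/-- `max_{x ∈ C∞,α, |x| ≤ n} |ψ(x)|`. -/
def maxPsi (d : ℕ) (ω : Env d) (α : ℝ) (ψ : Site d → Euc d) (n : ℝ) : ℝ :=
  sSup ((fun x => ‖ψ x‖) '' {x : Site d | x ∈ Cinfa d ω α ∧ ‖emb d x‖ ≤ n})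

/-- The number of sites `x ∈ C∞,α` with `|x| ≤ n` at which `|ψ(x)| ≥ ε n`. -/
def badCount (d : ℕ) (ω : Env d) (α : ℝ) (ψ : Site d → Euc d) (ε : ℝ) (n : ℕ) : ℕ :=
  Nat.card {x : Site d // x ∈ Cinfa d ω α ∧ ‖emb d x‖ ≤ n ∧ ε * n ≤ ‖ψ x‖}

/-- Lengths of paths from `x` to `y` using only edges of conductance `≥ α`
(graph distance on `C∞,α` is the least element of this set). -/
def gdSet (d : ℕ) (ω : Env d) (α : ℝ) (x y : Site d) : Set ℕ :=
  {n | ∃ γ : Fin (n + 1) → Site d, γ 0 = x ∧ γ (Fin.last n) = y ∧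
    ∀ k : Fin n, geRel d ω α (γ k.castSucc) (γ k.succ)}

/-- The graph distance on `C∞,α` (with value `∞` if there is no path). -/
def gdA (d : ℕ) (ω : Env d) (α : ℝ) (x y : Site d) : ℝ≥0∞ :=
  sInf ((fun n : ℕ => (n : ℝ≥0∞)) '' gdSet d ω α x y)

/-- Lengths of "jump paths" available to the walk `Y` on `C∞,α`: consecutive points are
linked by a jump of positive probability `ω̂ > 0`.  The jump distance `d(x,y)` of the
walk `Y` is the least element of this set. -/
def jumpDistSet (d : ℕ) (ω : Env d) (α : ℝ) (x y : Site d) : Set ℕ :=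
  {n | ∃ γ : Fin (n + 1) → Site d, γ 0 = x ∧ γ (Fin.last n) = y ∧
    ∀ k : Fin n, 0 < hatStep d ω α (γ k.castSucc) (γ k.succ)}

/-- The relation defining the components of `C∞ \ C∞,α`. -/
def weakRel (d : ℕ) (ω : Env d) (α : ℝ) (a b : Site d) : Prop :=
  adjacent d a b ∧ 0 < condOf d ω a b ∧
    a ∈ Cinf d ω \ Cinfa d ω α ∧ b ∈ Cinf d ω \ Cinfa d ω α

/-- `F(x)`: the connected component of `C∞ \ C∞,α` containing `x` (empty if
`x ∉ C∞ \ C∞,α`). -/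
def Fcomp (d : ℕ) (ω : Env d) (α : ℝ) (x : Site d) : Set (Site d) :=
  {y | x ∈ Cinf d ω \ Cinfa d ω α ∧ Relation.ReflTransGen (weakRel d ω α) x y}

/-- The `ℓ^∞` distance on `ℤ^d` (as a natural number). -/
def linfDist (d : ℕ) (x y : Site d) : ℕ :=
  Finset.univ.sup fun i => (x i - y i).natAbs


/-- The defining properties of the corrector `χ` (Theorem 3.1(1-3)):
`P_0`-a.s. it vanishes at the origin, is a shift-covariant gradient field on `C∞`,
makes `x + χ(ω,x)` harmonic for `L_ω`, and it has the square-integrability property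
w.r.t. every conditional law `P_α`. -/
def IsCorrector (d : ℕ) (P : Measure (Env d)) (χ : Env d → Site d → Euc d) : Prop :=
  (∀ᵐ ω ∂(ProbabilityTheory.cond P {ω' | (0 : Site d) ∈ Cinf d ω'}),
    χ ω 0 = 0 ∧
    (∀ x ∈ Cinf d ω, ∀ y ∈ Cinf d ω, χ ω x - χ ω y = χ (shiftBy d y ω) (x - y)) ∧
    (∀ x ∈ Cinf d ω, latOp d ω (fun z => emb d z + χ ω z) x = 0)) ∧
  (∀ α : ℝ, 0 < α → 0 < P {ω | (0 : Site d) ∈ Cinfa d ω α} →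
    ∃ C : ℝ, ∀ x y : Site d, adjacent d x y →
      ∫ ω, ‖χ ω y - χ ω x‖ ^ 2 * condOf d ω x y *
          Set.indicator {ω' : Env d | x ∈ Cinf d ω'} (fun _ => (1 : ℝ)) ω
        ∂(ProbabilityTheory.cond P {ω' | (0 : Site d) ∈ Cinfa d ω' α}) < C)

section KilledKernel

variable {V E : Type*} [NormedAddCommGroup E] [NormedSpace ℝ E]

/-- One step of the chain with transition probabilities `p` (of range `N`), killed on
entering `A`. -/
def killedStep (N : V → Finset V) (p : V → V → ℝ) (A : Set V) (g : V → E) (z : V) : E :=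
  ∑ w ∈ N z, p z w • (if w ∈ A then 0 else g w)

/-- `hitAt N p A n z y` is the probability that the chain started at `z` enters `A` for the
first time at time `n + 1`, and does so at `y`. -/
def hitAt (N : V → Finset V) (p : V → V → ℝ) (A : Set V) : ℕ → V → V → ℝ
  | 0 => fun z y => if y ∈ A then p z y else 0
  | n + 1 => fun z y => killedStep N p A (fun w => hitAt N p A n w y) z

variable {N : V → Finset V} {p : V → V → ℝ} {A : Set V}

lemma killedStep_congr {B : Finset V} (hB : ∀ z ∈ B, ∀ w, p z w ≠ 0 → w ∉ A → w ∈ B)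
    {g g' : V → E} (h : ∀ w ∈ B, g w = g' w) {z : V} (hz : z ∈ B) :
    killedStep N p A g z = killedStep N p A g' z := by
  refine Finset.sum_congr rfl fun w _ => ?_
  by_cases hp : p z w = 0
  · simp [hp]
  by_cases hw : w ∈ A
  · simp [hw]
  · simp [hw, h w (hB z hz w hp hw)]

lemma killedStep_sum {ι : Type*} (s : Finset ι) (g : ι → V → E) (z : V) :
    killedStep N p A (fun w => ∑ i ∈ s, g i w) z = ∑ i ∈ s, killedStep N p A (g i) z := by
  unfold killedStep
  rw [Finset.sum_comm]
  refine Finset.sum_congr rfl fun w _ => ?_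
  by_cases hw : w ∈ A <;> simp [hw, Finset.smul_sum]

lemma killedStep_add (g g' : V → E) (z : V) :
    killedStep N p A (fun w => g w + g' w) z =
      killedStep N p A g z + killedStep N p A g' z := by
  unfold killedStep
  rw [← Finset.sum_add_distrib]
  refine Finset.sum_congr rfl fun w _ => ?_
  by_cases hw : w ∈ A <;> simp [hw]

lemma killedStep_smul (g : V → ℝ) (v : E) (z : V) :
    killedStep N p A (fun w => g w • v) z = killedStep N p A g z • v := by
  unfold killedStep
  rw [Finset.sum_smul]
  refine Finset.sum_congr rfl fun w _ => ?_
  by_cases hw : w ∈ A <;> simp [hw, mul_smul]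

lemma killedStep_mono (hp : ∀ z w, 0 ≤ p z w) {g g' : V → ℝ} (h : ∀ w, g w ≤ g' w) (z : V) :
    killedStep N p A g z ≤ killedStep N p A g' z := by
  refine Finset.sum_le_sum fun w _ => mul_le_mul_of_nonneg_left ?_ (hp z w)
  split_ifs
  · exact le_rfl
  · exact h w

lemma killedStep_nonneg (hp : ∀ z w, 0 ≤ p z w) {g : V → ℝ} (h : ∀ w, 0 ≤ g w) (z : V) :
    0 ≤ killedStep N p A g z := by
  refine Finset.sum_nonneg fun w _ => mul_nonneg (hp z w) ?_
  split_ifs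
  · exact le_rfl
  · exact h w

/-- The chance of surviving forever in a finite set from which `A` is accessible is zero. -/
lemma tendsto_survival (hp : ∀ z w, 0 ≤ p z w) (hN : ∀ z w, p z w ≠ 0 → w ∈ N z)
    (hsum : ∀ z, ∑ w ∈ N z, p z w = 1)
    {B : Finset V} (hB : ∀ z ∈ B, ∀ w, p z w ≠ 0 → w ∉ A → w ∈ B)
    (hA : ∀ z ∈ B, ∃ a ∈ A, Relation.TransGen (fun u v => 0 < p u v) z a)
    {x : V} (hx : x ∈ B) :
    Tendsto (fun n => (killedStep N p A)^[n] (fun _ => (1 : ℝ)) x) atTop (𝓝 0) := by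
  set S : ℕ → V → ℝ := fun n => (killedStep N p A)^[n] (fun _ => (1 : ℝ)) with hS
  have hSs : ∀ n, S (n + 1) = killedStep N p A (S n) := fun n =>
    Function.iterate_succ_apply' _ _ _
  have h0 : ∀ n z, 0 ≤ S n z := by
    intro n
    induction n with
    | zero => intro z; simp [hS]
    | succ n ih => intro z; rw [hSs]; exact killedStep_nonneg hp ih z
  have h1 : ∀ n z, S (n + 1) z ≤ S n z := by
    intro n
    induction n with
    | zero =>
      intro z
      rw [hSs]
      calc killedStep N p A (S 0) z ≤ ∑ w ∈ N z, p z w := by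
            refine Finset.sum_le_sum fun w _ => ?_
            by_cases hw : w ∈ A <;> simp [hw, hS, hp]
        _ = S 0 z := by simp [hsum, hS]
    | succ n ih =>
      intro z
      have := killedStep_mono (N := N) (A := A) hp ih z
      rwa [← hSs, ← hSs] at this
  have hlim : ∀ z, Tendsto (fun n => S n z) atTop (𝓝 (⨅ n, S n z)) := fun z =>
    tendsto_atTop_ciInf (antitone_nat_of_succ_le fun n => h1 n z)
      ⟨0, by rintro _ ⟨n, rfl⟩; exact h0 n z⟩
  set s : V → ℝ := fun z => ⨅ n, S n z with hs
  have hs0 : ∀ z, 0 ≤ s z := fun z => le_ciInf fun n => h0 n z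
  have hfix : ∀ z, s z = ∑ w ∈ N z, p z w * (if w ∈ A then 0 else s w) := by
    intro z
    refine tendsto_nhds_unique ((tendsto_add_atTop_iff_nat 1).2 (hlim z)) ?_
    simp only [hSs]
    refine tendsto_finsetSum _ fun w _ => ?_
    refine Tendsto.const_mul _ ?_
    by_cases hw : w ∈ A
    · simp [hw]
    · simpa [hw] using hlim w
  obtain ⟨m, hmB, hm⟩ := B.exists_max_image s ⟨x, hx⟩
  have hprop : 0 < s m → ∀ z ∈ B, s z = s m → ∀ w, 0 < p z w →
      w ∉ A ∧ w ∈ B ∧ s w = s m := by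
    intro hpos z hz hzm w hw
    have hle : ∀ v ∈ N z, 0 ≤ p z v * (s m - (if v ∈ A then 0 else s v)) := by
      intro v _
      by_cases hv0 : p z v = 0
      · simp [hv0]
      refine mul_nonneg (hp z v) ?_
      by_cases hv : v ∈ A
      · simp [hv, hpos.le]
      · simpa [hv] using hm v (hB z hz v hv0 hv)
    have hzero : ∑ v ∈ N z, p z v * (s m - (if v ∈ A then 0 else s v)) = 0 := by
      simp only [mul_sub, Finset.sum_sub_distrib]
      rw [← Finset.sum_mul, hsum, ← hfix z, hzm]
      ring
    have hw' := (Finset.sum_eq_zero_iff_of_nonneg hle).1 hzero w (hN z w hw.ne')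
    have hw'' := (mul_eq_zero.1 hw').resolve_left hw.ne'
    by_cases hwA : w ∈ A
    · simp only [hwA, if_true] at hw''
      linarith
    · simp only [hwA, if_false] at hw''
      exact ⟨hwA, hB z hz w hw.ne' hwA, by linarith⟩
  have hm0 : s m = 0 := by
    by_contra hne
    have hpos := lt_of_le_of_ne (hs0 m) (Ne.symm hne)
    obtain ⟨a, haA, ha⟩ := hA m hmB
    have : a ∉ A ∧ a ∈ B ∧ s a = s m := by
      clear haA
      induction ha with
      | single h => exact hprop hpos m hmB rfl _ h
      | tail _ h ih => exact hprop hpos _ ih.2.1 ih.2.2 _ h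
    exact this.1 haA
  have hx0 : s x = 0 := le_antisymm (hm0 ▸ hm x hx) (hs0 x)
  have := hlim x
  change Tendsto (fun n => S n x) atTop (𝓝 (s x)) at this
  rwa [hx0] at this

lemma norm_iterate_killedStep_le (hp : ∀ z w, 0 ≤ p z w)
    {B : Finset V} (hB : ∀ z ∈ B, ∀ w, p z w ≠ 0 → w ∉ A → w ∈ B)
    {g : V → E} {M : ℝ} (hM : ∀ z ∈ B, ‖g z‖ ≤ M) (n : ℕ) :
    ∀ z ∈ B, ‖(killedStep N p A)^[n] g z‖ ≤
      M * (killedStep N p A)^[n] (fun _ => (1 : ℝ)) z := by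
  induction n with
  | zero => intro z hz; simpa using hM z hz
  | succ n ih =>
    intro z hz
    simp only [Function.iterate_succ_apply']
    unfold killedStep at ih ⊢
    rw [Finset.mul_sum]
    refine (norm_sum_le _ _).trans (Finset.sum_le_sum fun w _ => ?_)
    by_cases hp0 : p z w = 0
    · simp [hp0]
    by_cases hw : w ∈ A
    · simp [hw]
    · have := mul_le_mul_of_nonneg_left (ih w (hB z hz w hp0 hw)) (hp z w)
      simp only [hw, if_false, norm_smul, Real.norm_eq_abs, abs_of_nonneg (hp z w), smul_eq_mul]
        at this ⊢
      linarith

lemma hitAt_nonneg (hp : ∀ z w, 0 ≤ p z w) (n : ℕ) : ∀ z y, 0 ≤ hitAt N p A n z y := by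
  induction n with
  | zero => intro z y; unfold hitAt; split_ifs <;> simp [hp]
  | succ n ih => intro z y; exact killedStep_nonneg hp (fun w => ih w y) z

lemma hitAt_eq_zero [DecidableEq V] (hN : ∀ z w, p z w ≠ 0 → w ∈ N z)
    {B : Finset V} (hB : ∀ z ∈ B, ∀ w, p z w ≠ 0 → w ∉ A → w ∈ B)
    {y : V} (hy : y ∉ B.biUnion N) (n : ℕ) : ∀ z ∈ B, hitAt N p A n z y = 0 := by
  induction n with
  | zero =>
    intro z hz
    have : p z y = 0 := by
      by_contra h
      exact hy (Finset.mem_biUnion.2 ⟨z, hz, hN z y h⟩)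
    simp [hitAt, this]
  | succ n ih =>
    intro z hz
    change killedStep N p A (fun w => hitAt N p A n w y) z = 0
    rw [killedStep_congr hB (g' := fun _ => 0) ih hz]
    simp [killedStep]

/-- Optional stopping at time `n` for a function that is harmonic on `B`. -/
lemma harmonic_eq_sum_hitAt_add [DecidableEq V] (hN : ∀ z w, p z w ≠ 0 → w ∈ N z)
    {B : Finset V} (hB : ∀ z ∈ B, ∀ w, p z w ≠ 0 → w ∉ A → w ∈ B)
    {g : V → E} (hg : ∀ z ∈ B, g z = ∑ w ∈ N z, p z w • g w) (n : ℕ) :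
    ∀ z ∈ B, g z = (∑ k ∈ Finset.range n, ∑ y ∈ B.biUnion N, hitAt N p A k z y • g y) +
      (killedStep N p A)^[n] g z := by
  induction n with
  | zero => intro z _; simp
  | succ n ih =>
    intro z hz
    have hstep : g z = (∑ y ∈ B.biUnion N, hitAt N p A 0 z y • g y) + killedStep N p A g z := by
      have hsub : N z ⊆ B.biUnion N := Finset.subset_biUnion_of_mem N hz
      rw [← Finset.sum_subset hsub, killedStep, ← Finset.sum_add_distrib, hg z hz]
      · refine Finset.sum_congr rfl fun w _ => ?_
        by_cases hw : w ∈ A <;> simp [hitAt, hw]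
      · intro y _ hy
        have : p z y = 0 := by
          by_contra h
          exact hy (hN z y h)
        simp [hitAt, this]
    rw [Finset.sum_range_succ', Function.iterate_succ_apply', hstep, killedStep_congr hB ih hz,
      killedStep_add, killedStep_sum]
    simp only [killedStep_sum, killedStep_smul]
    simp only [hitAt]
    abel

/-- A function harmonic on `B` and vanishing at `x ∈ B` has zero mean under the law of the
place where the chain started at `x` first enters `A`. -/
lemma sum_tsum_hitAt_smul_eq_zero [DecidableEq V] (hp : ∀ z w, 0 ≤ p z w) (hN : ∀ z w, p z w ≠ 0 → w ∈ N z)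
    (hsum : ∀ z, ∑ w ∈ N z, p z w = 1)
    {B : Finset V} (hB : ∀ z ∈ B, ∀ w, p z w ≠ 0 → w ∉ A → w ∈ B)
    (hA : ∀ z ∈ B, ∃ a ∈ A, Relation.TransGen (fun u v => 0 < p u v) z a)
    {x : V} (hx : x ∈ B)
    {g : V → E} (hg : ∀ z ∈ B, g z = ∑ w ∈ N z, p z w • g w) (hgx : g x = 0) :
    ∑ y ∈ B.biUnion N, (∑' n, hitAt N p A n x y) • g y = 0 := by
  have hsummable : ∀ y ∈ B.biUnion N, Summable fun n => hitAt N p A n x y := by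
    intro y hy
    refine summable_of_sum_range_le (c := 1) (fun n => hitAt_nonneg hp n x y) fun n => ?_
    have h := harmonic_eq_sum_hitAt_add (g := fun _ => (1 : ℝ)) hN hB
      (fun z _ => by simp [hsum]) n x hx
    have h0 : ∀ (n : ℕ) (z : V), 0 ≤ (killedStep N p A)^[n] (fun _ => (1 : ℝ)) z := by
      intro n
      induction n with
      | zero => intro z; simp
      | succ n ih =>
        intro z
        rw [Function.iterate_succ_apply']
        exact killedStep_nonneg hp ih z
    have h2 : ∑ k ∈ Finset.range n, hitAt N p A k x y ≤
        ∑ k ∈ Finset.range n, ∑ y ∈ B.biUnion N, hitAt N p A k x y • (1 : ℝ) := by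
      refine Finset.sum_le_sum fun k _ => ?_
      simp only [smul_eq_mul, mul_one]
      exact Finset.single_le_sum (f := fun y => hitAt N p A k x y)
        (fun y _ => hitAt_nonneg hp k x y) hy
    have := h0 n x
    linarith
  obtain ⟨M, hM⟩ : ∃ M, ∀ z ∈ B, ‖g z‖ ≤ M :=
    ⟨∑ z ∈ B, ‖g z‖, fun z hz =>
      Finset.single_le_sum (f := fun z => ‖g z‖) (fun z _ => norm_nonneg _) hz⟩
  have hdecay : Tendsto (fun n => (killedStep N p A)^[n] g x) atTop (𝓝 0) := by
    refine squeeze_zero_norm (fun n => norm_iterate_killedStep_le hp hB hM n x hx) ?_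
    simpa using (tendsto_survival hp hN hsum hB hA hx).const_mul M
  have hconv : Tendsto (fun n => ∑ k ∈ Finset.range n, ∑ y ∈ B.biUnion N,
      hitAt N p A k x y • g y) atTop
      (𝓝 (∑ y ∈ B.biUnion N, (∑' n, hitAt N p A n x y) • g y)) := by
    have : ∀ n, ∑ k ∈ Finset.range n, ∑ y ∈ B.biUnion N, hitAt N p A k x y • g y =
        ∑ y ∈ B.biUnion N, (∑ k ∈ Finset.range n, hitAt N p A k x y) • g y := by
      intro n
      rw [Finset.sum_comm]
      simp only [Finset.sum_smul]
    simp only [this]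
    exact tendsto_finsetSum _ fun y hy =>
      (hsummable y hy).hasSum.tendsto_sum_nat.smul_const (g y)
  refine tendsto_nhds_unique hconv ?_
  have : ∀ n, ∑ k ∈ Finset.range n, ∑ y ∈ B.biUnion N, hitAt N p A k x y • g y =
      -(killedStep N p A)^[n] g x := by
    intro n
    have := harmonic_eq_sum_hitAt_add hN hB hg n x hx
    rw [hgx] at this
    exact eq_neg_of_add_eq_zero_left this.symm
  simp only [this]
  simpa using hdecay.neg

/-- The weights of the paths of length `n + 1` from `x` to `y` that enter `A` exactly at their
end add up to `hitAt`. -/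
lemma hasSum_path_hitAt [DecidableEq V] (hN : ∀ z w, p z w ≠ 0 → w ∈ N z) (n : ℕ) : ∀ x y : V,
    HasSum (fun γ : Fin (n + 2) → V =>
      if γ 0 = x ∧ γ (Fin.last (n + 1)) = y ∧ y ∈ A ∧
          (∀ k : Fin (n + 2), k ≠ 0 → k ≠ Fin.last (n + 1) → γ k ∉ A)
      then ∏ k : Fin (n + 1), p (γ k.castSucc) (γ k.succ) else 0)
      (hitAt N p A n x y) := by
  induction n with
  | zero =>
    intro x y
    have h := hasSum_single (f := fun γ : Fin 2 → V =>
      if γ 0 = x ∧ γ (Fin.last 1) = y ∧ y ∈ A ∧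
          (∀ k : Fin 2, k ≠ 0 → k ≠ Fin.last 1 → γ k ∉ A)
      then ∏ k : Fin 1, p (γ k.castSucc) (γ k.succ) else 0) ![x, y] (by
        intro γ hγ
        rw [if_neg]
        rintro ⟨h0, h1, -⟩
        apply hγ
        funext k
        fin_cases k
        · exact h0
        · exact h1)
    convert h using 1
    have hk : ∀ k : Fin 2, k ≠ 0 → k ≠ Fin.last 1 → (![x, y] : Fin 2 → V) k ∉ A := by
      intro k h0 h1
      fin_cases k
      · exact absurd rfl h0
      · exact absurd rfl h1
    have h1 : (![x, y] : Fin 2 → V) (Fin.last 1) = y := rfl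
    by_cases hy : y ∈ A
    · rw [if_pos ⟨rfl, h1, hy, hk⟩]
      simp [hitAt, hy]
    · rw [if_neg fun h => hy h.2.2.1]
      simp [hitAt, hy]
  | succ n ih =>
    intro x y
    have hinj : Function.Injective (fun γ : Fin (n + 2) → V =>
        (Fin.cons x γ : Fin (n + 3) → V)) := Fin.cons_right_injective (α := fun _ => V) x
    rw [← hinj.hasSum_iff]
    · have := hasSum_sum (s := N x) fun w _ =>
        ((ih w y).mul_left (p x w * (if w ∈ A then 0 else 1)))
      have hval : ∑ w ∈ N x, p x w * (if w ∈ A then 0 else 1) * hitAt N p A n w y =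
          hitAt N p A (n + 1) x y := by
        simp only [hitAt, killedStep, smul_eq_mul]
        refine Finset.sum_congr rfl fun w _ => ?_
        by_cases hw : w ∈ A <;> simp [hw]
      rw [hval] at this
      refine (congrArg (HasSum · _) (funext fun γ => ?_)).mpr this
      simp only [Function.comp]
      rw [Finset.sum_eq_single (γ 0)]
      · have hlast : (Fin.cons x γ : Fin (n + 3) → V) (Fin.last (n + 1 + 1)) =
            γ (Fin.last (n + 1)) := rfl
        have hfor : (∀ k : Fin (n + 3), k ≠ 0 → k ≠ Fin.last (n + 1 + 1) →
            (Fin.cons x γ : Fin (n + 3) → V) k ∉ A) ↔ γ 0 ∉ A ∧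
            (∀ k : Fin (n + 2), k ≠ 0 → k ≠ Fin.last (n + 1) → γ k ∉ A) := by
          constructor
          · intro h
            refine ⟨h (Fin.succ 0) (Fin.succ_ne_zero _) ?_, fun k _ hk => ?_⟩
            · rw [← Fin.succ_last]
              exact fun h => (Fin.last_pos (n := n)).ne (Fin.succ_injective _ h)
            · have := h k.succ (Fin.succ_ne_zero _)
                (fun h => hk (Fin.succ_injective _ h))
              simpa using this
          · rintro ⟨h0, h⟩ k hk0 hk
            obtain ⟨j, rfl⟩ := Fin.exists_succ_eq.2 hk0
            by_cases hj : j = 0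
            · subst hj; simpa using h0
            · simpa using h j hj (fun h => hk (by rw [h]; rfl))
        simp only [hlast, hfor]
        rw [Fin.prod_univ_succ]
        by_cases h0 : γ 0 ∈ A
        · simp [h0]
        · simp only [h0, not_false_eq_true, true_and, Fin.cons_zero, if_false, mul_one,
            Fin.castSucc_zero, Fin.cons_succ, Fin.castSucc_succ, mul_ite, mul_zero]
      · intro w _ hw
        simp [Ne.symm hw]
      · intro h
        have : p x (γ 0) = 0 := by
          by_contra h'
          exact h (hN _ _ h')
        simp [this]
    · intro γ hγ
      rw [if_neg]
      rintro ⟨h0, -⟩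
      exact hγ ⟨Fin.tail γ, by rw [← h0]; exact Fin.cons_self_tail γ⟩

end KilledKernel

section Lattice

variable {d : ℕ} {ω : Env d} {α : ℝ}

lemma unitE_injective : Function.Injective (unitE d) := by
  intro i j h
  by_contra hij
  have := congrFun h i
  simp [unitE, hij] at this

lemma unitE_add_unitE_ne_zero (i j : Fin d) : unitE d i + unitE d j ≠ 0 := by
  intro h
  have := congrFun h i
  simp only [Pi.add_apply, unitE, Pi.zero_apply, if_true] at this
  split_ifs at this <;> omega

lemma unitE_ne_zero (i : Fin d) : unitE d i ≠ 0 := by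
  intro h
  have := congrFun h i
  simp [unitE] at this

lemma condOf_add (x : Site d) (i : Fin d) : condOf d ω x (x + unitE d i) = ω (x, i) := by
  have h : ∃ j, x + unitE d i = x + unitE d j := ⟨i, rfl⟩
  rw [condOf, dif_pos h, ← unitE_injective (add_left_cancel h.choose_spec)]

lemma condOf_sub (x : Site d) (i : Fin d) :
    condOf d ω x (x - unitE d i) = ω (x - unitE d i, i) := by
  have h : ¬ ∃ j, x - unitE d i = x + unitE d j := by
    rintro ⟨j, hj⟩
    refine unitE_add_unitE_ne_zero i j ?_
    rw [sub_eq_add_neg] at hj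
    rw [← add_left_cancel hj, add_neg_cancel]
  have h2 : ∃ j, x = x - unitE d i + unitE d j := ⟨i, by abel⟩
  rw [condOf, dif_neg h, dif_pos h2]
  congr 2
  apply unitE_injective
  apply add_left_cancel (a := x - unitE d i)
  rw [← h2.choose_spec, sub_add_cancel]

lemma adjacent.symm {x y : Site d} (h : adjacent d x y) : adjacent d y x := Or.symm h

lemma adjacent.ne {x y : Site d} (h : adjacent d x y) : x ≠ y := by
  rintro rfl
  rcases h with ⟨i, hi⟩ | ⟨i, hi⟩ <;> exact unitE_ne_zero i (by simpa using hi)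

lemma condOf_comm_of_adjacent {x y : Site d} (h : adjacent d x y) :
    condOf d ω x y = condOf d ω y x := by
  rcases h with ⟨i, rfl⟩ | ⟨i, rfl⟩
  · have := condOf_sub (ω := ω) (x + unitE d i) i
    rw [add_sub_cancel_right] at this
    rw [this, condOf_add]
  · have := condOf_sub (ω := ω) (y + unitE d i) i
    rw [add_sub_cancel_right] at this
    rw [this, condOf_add]

lemma openRel.symm {x y : Site d} (h : openRel d ω x y) : openRel d ω y x :=
  ⟨h.1.symm, condOf_comm_of_adjacent h.1 ▸ h.2⟩

lemma weakRel.symm {x y : Site d} (h : weakRel d ω α x y) : weakRel d ω α y x :=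
  ⟨h.1.symm, condOf_comm_of_adjacent h.1 ▸ h.2.1, h.2.2.2, h.2.2.1⟩

lemma Cinfa_subset_Cinf (hα : 0 < α) : Cinfa d ω α ⊆ Cinf d ω := fun _ hx =>
  Set.Infinite.mono (fun _ hy => Relation.ReflTransGen.mono
    (fun _ _ h => ⟨h.1, hα.trans_le h.2⟩) _ _ hy) hx

lemma Cinf_of_openRel {x y : Site d} (hx : x ∈ Cinf d ω) (h : openRel d ω x y) :
    y ∈ Cinf d ω :=
  Set.Infinite.mono (fun _ hz => Relation.ReflTransGen.head h.symm hz) hx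

lemma condOf_mem_Icc_add_sub (hω : ∀ e, ω e ∈ Set.Icc (0 : ℝ) 1) (x : Site d) (i : Fin d) :
    condOf d ω x (x + unitE d i) ∈ Set.Icc (0 : ℝ) 1 ∧
      condOf d ω x (x - unitE d i) ∈ Set.Icc (0 : ℝ) 1 := by
  rw [condOf_add, condOf_sub]
  exact ⟨hω _, hω _⟩

lemma condOf_nonneg (hω : ∀ e, ω e ∈ Set.Icc (0 : ℝ) 1) (x y : Site d) :
    0 ≤ condOf d ω x y := by
  unfold condOf
  split_ifs
  · exact (hω _).1
  · exact (hω _).1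
  · exact le_rfl

lemma degSum_le (hω : ∀ e, ω e ∈ Set.Icc (0 : ℝ) 1) (x : Site d) :
    degSum d ω x ≤ 2 * d := by
  calc degSum d ω x ≤ ∑ _i : Fin d, (2 : ℝ) := by
        refine Finset.sum_le_sum fun i _ => ?_
        have := condOf_mem_Icc_add_sub hω x i
        linarith [this.1.2, this.2.2]
    _ = 2 * d := by simp [mul_comm]

lemma stepProb_nonneg (hω : ∀ e, ω e ∈ Set.Icc (0 : ℝ) 1) (x y : Site d) :
    0 ≤ stepProb d ω x y := by
  unfold stepProb
  split_ifs
  · exact div_nonneg (condOf_nonneg hω x y) (by positivity)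
  · exact sub_nonneg.2 (div_le_one_of_le₀ (degSum_le hω x) (by positivity))
  · exact le_rfl

lemma stepProb_comm (x y : Site d) : stepProb d ω x y = stepProb d ω y x := by
  by_cases h : adjacent d x y
  · rw [stepProb, stepProb, if_pos h, if_pos h.symm, condOf_comm_of_adjacent h]
  · have h' : ¬ adjacent d y x := fun h' => h h'.symm
    by_cases hxy : y = x
    · rw [hxy]
    · rw [stepProb, stepProb, if_neg h, if_neg h', if_neg hxy, if_neg (Ne.symm hxy)]

lemma stepProb_of_adjacent {x y : Site d} (h : adjacent d x y) :
    stepProb d ω x y = (2 * (d : ℝ))⁻¹ * condOf d ω x y := by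
  rw [stepProb, if_pos h, div_eq_inv_mul]

/-- A site together with its nearest neighbours. -/
def closedNbhd (d : ℕ) (x : Site d) : Finset (Site d) :=
  insert x (Finset.univ.image (fun i => x + unitE d i) ∪
    Finset.univ.image (fun i => x - unitE d i))

lemma mem_closedNbhd {x y : Site d} : y ∈ closedNbhd d x ↔ y = x ∨ adjacent d x y := by
  simp only [closedNbhd, adjacent, Finset.mem_insert, Finset.mem_union, Finset.mem_image,
    Finset.mem_univ, true_and, sub_eq_iff_eq_add]
  simp only [eq_comm]

lemma eq_or_adjacent_of_stepProb_ne_zero {x y : Site d} (h : stepProb d ω x y ≠ 0) :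
    y = x ∨ adjacent d x y := by
  by_contra hc
  rw [not_or] at hc
  simp [stepProb, hc.1, hc.2] at h

lemma mem_closedNbhd_of_stepProb_ne_zero (x y : Site d) (h : stepProb d ω x y ≠ 0) :
    y ∈ closedNbhd d x :=
  mem_closedNbhd.2 (eq_or_adjacent_of_stepProb_ne_zero h)

lemma openRel_of_stepProb_ne_zero (hω : ∀ e, ω e ∈ Set.Icc (0 : ℝ) 1) {x y : Site d}
    (hxy : y ≠ x) (h : stepProb d ω x y ≠ 0) : openRel d ω x y := by
  have hadj := (eq_or_adjacent_of_stepProb_ne_zero h).resolve_left hxy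
  refine ⟨hadj, lt_of_le_of_ne (condOf_nonneg hω x y) fun h0 => h ?_⟩
  simp [stepProb, hadj, ← h0]

lemma stepProb_pos_of_openRel (hd : 0 < d) {x y : Site d} (h : openRel d ω x y) :
    0 < stepProb d ω x y := by
  rw [stepProb, if_pos h.1]
  exact div_pos h.2 (by positivity)

lemma sum_closedNbhd {E : Type*} [AddCommMonoid E] (g : Site d → E) (x : Site d) :
    ∑ w ∈ closedNbhd d x, g w =
      g x + ∑ i : Fin d, (g (x + unitE d i) + g (x - unitE d i)) := by
  have h1 : Function.Injective fun i => x + unitE d i :=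
    (add_right_injective x).comp unitE_injective
  have h2 : Function.Injective fun i => x - unitE d i :=
    (sub_right_injective (b := x)).comp unitE_injective
  rw [closedNbhd, Finset.sum_insert, Finset.sum_union, Finset.sum_image h1.injOn,
    Finset.sum_image h2.injOn, Finset.sum_add_distrib]
  · rw [Finset.disjoint_left]
    intro w hw hw'
    obtain ⟨i, -, rfl⟩ := Finset.mem_image.1 hw
    obtain ⟨j, -, hj⟩ := Finset.mem_image.1 hw'
    refine unitE_add_unitE_ne_zero i j ?_
    rw [sub_eq_add_neg] at hj
    rw [← add_left_cancel hj, neg_add_cancel]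
  · simp [unitE_ne_zero]

lemma sum_stepProb_smul {E : Type*} [AddCommGroup E] [Module ℝ E]
    (g : Site d → E) (x : Site d) :
    ∑ w ∈ closedNbhd d x, stepProb d ω x w • g w =
      g x + (2 * (d : ℝ))⁻¹ • ∑ i : Fin d,
        (condOf d ω x (x + unitE d i) • (g (x + unitE d i) - g x) +
          condOf d ω x (x - unitE d i) • (g (x - unitE d i) - g x)) := by
  have hxx : stepProb d ω x x = 1 - (2 * (d : ℝ))⁻¹ * degSum d ω x := by
    rw [stepProb, if_neg (fun h => h.ne rfl), if_pos rfl, div_eq_inv_mul]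
  have ha : ∀ i, stepProb d ω x (x + unitE d i) =
      (2 * (d : ℝ))⁻¹ * condOf d ω x (x + unitE d i) := fun i =>
    stepProb_of_adjacent (Or.inl ⟨i, rfl⟩)
  have hs : ∀ i, stepProb d ω x (x - unitE d i) =
      (2 * (d : ℝ))⁻¹ * condOf d ω x (x - unitE d i) := fun i =>
    stepProb_of_adjacent (Or.inr ⟨i, by abel⟩)
  rw [sum_closedNbhd, hxx]
  simp only [ha, hs, degSum]
  simp only [sub_smul, one_smul, mul_smul, Finset.sum_smul, smul_sub, Finset.smul_sum, smul_add,
    Finset.sum_add_distrib, Finset.sum_sub_distrib, add_smul]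
  abel

lemma sum_stepProb (x : Site d) :
    ∑ w ∈ closedNbhd d x, stepProb d ω x w = 1 := by
  simpa using sum_stepProb_smul (ω := ω) (fun _ => (1 : ℝ)) x

lemma hatStep_eq_tsum_hitAt (x y : Site d) :
    hatStep d ω α x y =
      ∑' n, hitAt (closedNbhd d) (stepProb d ω) (Cinfa d ω α) n x y := by
  unfold hatStep
  refine tsum_congr fun n => ?_
  have := (hasSum_path_hitAt (A := Cinfa d ω α)
    (mem_closedNbhd_of_stepProb_ne_zero (ω := ω)) n x y).tsum_eq
  rw [← this]

/-- The sites visited by the walk started at `x` before it first returns to the strong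
cluster. -/
def excursionSites (d : ℕ) (ω : Env d) (α : ℝ) (x : Site d) : Set (Site d) :=
  insert x (⋃ y ∈ closedNbhd d x, if openRel d ω x y then Fcomp d ω α y else ∅)

lemma excursionSites_finite (hF : ∀ x, (Fcomp d ω α x).Finite) (x : Site d) :
    (excursionSites d ω α x).Finite := by
  refine Set.Finite.insert _ (Set.Finite.biUnion (Finset.finite_toSet _) fun y _ => ?_)
  split_ifs
  · exact hF y
  · exact Set.finite_empty

lemma mem_excursionSites {x z : Site d} : z ∈ excursionSites d ω α x ↔
    z = x ∨ ∃ y, openRel d ω x y ∧ z ∈ Fcomp d ω α y := by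
  simp only [excursionSites, Set.mem_insert_iff, Set.mem_iUnion]
  refine or_congr Iff.rfl ⟨?_, ?_⟩
  · rintro ⟨y, -, h⟩
    split_ifs at h with ho
    · exact ⟨y, ho, h⟩
    · exact h.elim
  · rintro ⟨y, ho, h⟩
    exact ⟨y, mem_closedNbhd.2 (Or.inr ho.1), by rwa [if_pos ho]⟩

lemma Fcomp_subset {y : Site d} : Fcomp d ω α y ⊆ Cinf d ω \ Cinfa d ω α := by
  rintro z ⟨hy, h⟩
  rcases Relation.ReflTransGen.cases_tail h with rfl | ⟨w, -, hw⟩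
  · exact hy
  · exact hw.2.2.2

lemma excursionSites_subset_Cinf {x : Site d} (hx : x ∈ Cinf d ω) :
    excursionSites d ω α x ⊆ Cinf d ω := by
  intro z hz
  rcases mem_excursionSites.1 hz with rfl | ⟨y, -, h⟩
  · exact hx
  · exact (Fcomp_subset h).1

lemma excursionSites_step (hω : ∀ e, ω e ∈ Set.Icc (0 : ℝ) 1) {x z w : Site d}
    (hx : x ∈ Cinf d ω) (hz : z ∈ excursionSites d ω α x) (hp : stepProb d ω z w ≠ 0)
    (hw : w ∉ Cinfa d ω α) : w ∈ excursionSites d ω α x := by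
  by_cases hwz : w = z
  · rwa [hwz]
  have ho := openRel_of_stepProb_ne_zero hω hwz hp
  have hwC : w ∈ Cinf d ω \ Cinfa d ω α :=
    ⟨Cinf_of_openRel (excursionSites_subset_Cinf hx hz) ho, hw⟩
  rw [mem_excursionSites] at hz ⊢
  right
  rcases hz with rfl | ⟨y, hy, hz⟩
  · exact ⟨w, ho, hwC, .refl⟩
  · exact ⟨y, hy, hz.1, hz.2.tail ⟨ho.1, ho.2, Fcomp_subset hz, hwC⟩⟩

lemma excursionSites_returns (hd : 0 < d) (hω : ∀ e, ω e ∈ Set.Icc (0 : ℝ) 1)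
    {x z : Site d} (hz : z ∈ excursionSites d ω α x) :
    Relation.TransGen (fun u v => 0 < stepProb d ω u v) z x := by
  rcases mem_excursionSites.1 hz with rfl | ⟨y, hy, hz⟩
  · obtain ⟨w, -, hw⟩ := Finset.exists_ne_zero_of_sum_ne_zero
      (by rw [sum_stepProb (ω := ω) z]; exact one_ne_zero)
    have hpos := lt_of_le_of_ne (stepProb_nonneg hω z w) (Ne.symm hw)
    exact .tail (.single hpos) (stepProb_comm z w ▸ hpos)
  · have hzy : Relation.ReflTransGen (fun u v => 0 < stepProb d ω u v) z y := by
      have : Std.Symm (weakRel d ω α) := ⟨fun _ _ h => h.symm⟩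
      have hsymm := Relation.ReflTransGen.stdSymm.symm _ _ hz.2
      exact Relation.ReflTransGen.mono
        (fun u v h => stepProb_pos_of_openRel hd ⟨h.1, h.2.1⟩) _ _ hsymm
    exact .tail' hzy (stepProb_pos_of_openRel hd hy.symm)

/-- A function harmonic on the infinite cluster is harmonic for the walk observed on the
strong cluster. -/
lemma genLa_eq_zero (hd : 0 < d) (hα : 0 < α) (hω : ∀ e, ω e ∈ Set.Icc (0 : ℝ) 1)
    (hF : ∀ x, (Fcomp d ω α x).Finite) {f : Site d → Euc d}
    (hf : ∀ x ∈ Cinf d ω, latOp d ω f x = 0) {x : Site d} (hx : x ∈ Cinfa d ω α) :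
    genLa d ω α f x = 0 := by
  have hxC : x ∈ Cinf d ω := Cinfa_subset_Cinf hα hx
  set B : Finset (Site d) := (excursionSites_finite hF x).toFinset with hBdef
  have hmem : ∀ z, z ∈ B ↔ z ∈ excursionSites d ω α x := fun z => Set.Finite.mem_toFinset _
  have hB : ∀ z ∈ B, ∀ w, stepProb d ω z w ≠ 0 → w ∉ Cinfa d ω α → w ∈ B :=
    fun z hz w hp hw => (hmem w).2 (excursionSites_step hω hxC ((hmem z).1 hz) hp hw)
  have hxB : x ∈ B := (hmem x).2 (mem_excursionSites.2 (Or.inl rfl))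
  have hN := mem_closedNbhd_of_stepProb_ne_zero (ω := ω)
  have hg : ∀ z ∈ B, f z - f x =
      ∑ w ∈ closedNbhd d z, stepProb d ω z w • (f w - f x) := by
    intro z hz
    have h := hf z (excursionSites_subset_Cinf hxC ((hmem z).1 hz))
    rw [latOp] at h
    simp only [smul_sub, Finset.sum_sub_distrib]
    rw [← Finset.sum_smul, sum_stepProb, sum_stepProb_smul, h, one_smul, add_zero]
  have key := sum_tsum_hitAt_smul_eq_zero (stepProb_nonneg hω) hN sum_stepProb hB
    (fun z hz => ⟨x, hx, excursionSites_returns hd hω ((hmem z).1 hz)⟩) hxB hg (sub_self _)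
  unfold genLa
  rw [tsum_eq_sum (s := B.biUnion (closedNbhd d))]
  · simpa only [hatStep_eq_tsum_hitAt] using key
  · intro y hy
    rw [hatStep_eq_tsum_hitAt]
    simp [hitAt_eq_zero hN hB hy _ x hxB]

end Lattice

lemma ae_mem_of_isIIDLaw {ι : Type*} [Countable ι] {P : Measure (ι → ℝ)} {μ : Measure ℝ}
    [IsProbabilityMeasure μ] (hP : IsIIDLaw P μ) {s : Set ℝ} (hs : MeasurableSet s)
    (hμ : μ sᶜ = 0) : ∀ᵐ ω ∂P, ∀ i, ω i ∈ s := by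
  have := hP.1
  rw [ae_all_iff]
  intro i
  have hμs : μ s = 1 := (prob_compl_eq_zero_iff hs).1 hμ
  have h := hP.2 {i} (fun _ => s) fun _ => hs
  simp only [Finset.mem_singleton, forall_eq, Finset.prod_singleton, hμs] at h
  exact (mem_ae_iff_prob_eq_one (measurable_pi_apply i hs)).2 h

/-- **Lemma 4.5** (harmonicity of `φ_ω` on `C∞,α`).  Let `χ` be the corrector on `C∞` and
`φ_ω(x) := x + χ(ω,x)`.  Then `φ_ω` is harmonic for the random walk observed only on
`C∞,α`, i.e. `(L_ω^{(α)} φ_ω)(x) = 0` for all `x ∈ C∞,α`. -/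
theorem statement10 (d : ℕ) (hd : 2 ≤ d)
    (μ : Measure ℝ) [IsProbabilityMeasure μ] (hsupp : μ (Set.Icc (0 : ℝ) 1)ᶜ = 0)
    (P : Measure (Env d)) (hP : IsIIDLaw P μ)
    (hperc : pc d < (μ {x : ℝ | 0 < x}).toReal)
    (α : ℝ) (hα0 : 0 < α)
    (hα1 : pc d < (μ {x : ℝ | α ≤ x}).toReal)
    (hα2 : ∀ᵐ ω ∂P, ∀ x : Site d, (Fcomp d ω α x).Finite)
    (χ : Env d → Site d → Euc d) (hχ : IsCorrector d P χ) :
    ∀ᵐ ω ∂(ProbabilityTheory.cond P {ω' | (0 : Site d) ∈ Cinfa d ω' α}),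
      ∀ x ∈ Cinfa d ω α, genLa d ω α (fun z => emb d z + χ ω z) x = 0 := by
  have := hP.1
  have hsub : {ω : Env d | (0 : Site d) ∈ Cinfa d ω α} ⊆ {ω | (0 : Site d) ∈ Cinf d ω} :=
    fun ω h => Cinfa_subset_Cinf hα0 h
  have hac : cond P {ω' | (0 : Site d) ∈ Cinfa d ω' α} ≪
      cond P {ω' | (0 : Site d) ∈ Cinf d ω'} := by
    refine (Measure.smul_absolutelyContinuous).trans
      ((Measure.absolutelyContinuous_of_le (Measure.restrict_mono hsub le_rfl)).trans ?_)
    exact Measure.absolutelyContinuous_smul (ENNReal.inv_ne_zero.2 (measure_ne_top _ _))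
  have hacP : cond P {ω' | (0 : Site d) ∈ Cinfa d ω' α} ≪ P := cond_absolutelyContinuous
  filter_upwards [hac.ae_le hχ.1, hacP.ae_le hα2,
    hacP.ae_le (ae_mem_of_isIIDLaw hP measurableSet_Icc hsupp)] with ω h1 h2 h3 x hx
  exact genLa_eq_zero (by omega) hα0 h3 h2 h1.2.2 hx

end RCRW
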